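/- arXiv:1707.02689 — 2 statements merged into one kernel-verified Lean document; each statement's English description precedes it below -/
import Mathlib

section
/- Let A, B : (0,∞) → (0,∞) be continuous, and let a, b : (0,∞) → (0,∞) satisfy a'(t) = A(a(t)) and b'(t) = B(b(t)) for all sufficiently large t, with a(t), b(t) → ∞. If liminf_{x→∞} A(x)/B(x) > 1, then a(t) > b(t) for all sufficiently large t. -/
open Filter Set

theorem stmt_7 (A B : ℝ → ℝ)
    (hApos : ∀ x, 0 < x → 0 < A x) (hBpos : ∀ x, 0 < x → 0 < B x)
    (hAcont : ContinuousOn A (Ioi 0)) (hBcont : ContinuousOn B (Ioi 0))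
    (a b : ℝ → ℝ)
    (hapos : ∀ t, 0 < t → 0 < a t) (hbpos : ∀ t, 0 < t → 0 < b t)
    (haode : ∃ t₀, ∀ t ≥ t₀, HasDerivAt a (A (a t)) t)
    (hbode : ∃ t₀, ∀ t ≥ t₀, HasDerivAt b (B (b t)) t)
    (hatop : Tendsto a atTop atTop) (hbtop : Tendsto b atTop atTop)
    (hliminf : 1 < liminf (fun x => A x / B x) atTop) :
    ∀ᶠ t in atTop, b t < a t := by
  obtain ⟨c, hc1, hc⟩ := exists_between hliminf
  have hbdd : IsBoundedUnder (· ≥ ·) atTop (fun x => A x / B x) := by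
    refine ⟨0, ?_⟩
    rw [eventually_map]
    filter_upwards [eventually_gt_atTop (0 : ℝ)] with x hx
    exact (div_pos (hApos x hx) (hBpos x hx)).le
  have hev : ∀ᶠ x in atTop, c < A x / B x := eventually_lt_of_lt_liminf hc hbdd
  have hIcont : ContinuousOn (fun x => (B x)⁻¹) (Ioi 0) :=
    hBcont.inv₀ (fun x hx => (hBpos x hx).ne')
  obtain ⟨F, hF⟩ : ∃ F : ℝ → ℝ, ∀ x, 0 < x → HasDerivAt F ((B x)⁻¹) x := by
    refine ⟨fun x => ∫ y in (1 : ℝ)..x, (B y)⁻¹, fun x hx => ?_⟩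
    apply intervalIntegral.integral_hasDerivAt_right
    · apply ContinuousOn.intervalIntegrable
      apply hIcont.mono
      intro y hy
      have h1 : min 1 x ≤ y := hy.1
      exact lt_of_lt_of_le (lt_min one_pos hx) h1
    · exact hIcont.stronglyMeasurableAtFilter isOpen_Ioi x hx
    · exact hIcont.continuousAt (Ioi_mem_nhds hx)
  have hFmono : MonotoneOn F (Ioi 0) := by
    apply monotoneOn_of_deriv_nonneg (convex_Ioi 0)
    · exact fun x hx => (hF x hx).continuousAt.continuousWithinAt
    · intro x hx
      rw [interior_Ioi] at hx
      exact (hF x hx).differentiableAt.differentiableWithinAt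
    · intro x hx
      rw [interior_Ioi] at hx
      rw [(hF x hx).deriv]
      exact (inv_pos.2 (hBpos x hx)).le
  obtain ⟨t₁, h₁⟩ := haode
  obtain ⟨t₂, h₂⟩ := hbode
  obtain ⟨t₃, h₃⟩ := eventually_atTop.1 (hatop.eventually hev)
  obtain ⟨T, hT⟩ : ∃ T : ℝ, ∀ t ≥ T, 0 < t ∧ t₁ ≤ t ∧ t₂ ≤ t ∧ t₃ ≤ t :=
    eventually_atTop.1 ((eventually_gt_atTop 0).and ((eventually_ge_atTop t₁).and
      ((eventually_ge_atTop t₂).and (eventually_ge_atTop t₃))))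
  have hG : ∀ t ≥ T, HasDerivAt (fun t => F (a t) - F (b t) - (c - 1) * t)
      ((B (a t))⁻¹ * A (a t) - (B (b t))⁻¹ * B (b t) - (c - 1) * 1) t := by
    intro t ht
    obtain ⟨h0, ha, hb, -⟩ := hT t ht
    exact (((hF _ (hapos t h0)).comp t (h₁ t ha)).sub
      ((hF _ (hbpos t h0)).comp t (h₂ t hb))).sub ((hasDerivAt_id t).const_mul (c - 1))
  have hGmono : MonotoneOn (fun t => F (a t) - F (b t) - (c - 1) * t) (Ici T) := by
    apply monotoneOn_of_deriv_nonneg (convex_Ici T)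
    · exact fun t ht => (hG t ht).continuousAt.continuousWithinAt
    · intro t ht
      exact (hG t (interior_subset ht)).differentiableAt.differentiableWithinAt
    · intro t ht
      have ht' : T ≤ t := interior_subset ht
      obtain ⟨h0, -, -, hd⟩ := hT t ht'
      rw [(hG t ht').deriv, inv_mul_cancel₀ (hBpos _ (hbpos t h0)).ne']
      have := h₃ t hd
      rw [div_eq_inv_mul] at this
      linarith
  have hlin : Tendsto (fun t : ℝ => (c - 1) * t) atTop atTop :=
    tendsto_id.const_mul_atTop (by linarith)
  filter_upwards [eventually_ge_atTop T,
    hlin.eventually_gt_atTop (-(F (a T) - F (b T) - (c - 1) * T))] with t ht hgt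
  have h0 := (hT t ht).1
  have hm := hGmono (mem_Ici.2 le_rfl) (mem_Ici.2 ht) ht
  by_contra hle
  have := hFmono (hapos t h0) (hbpos t h0) (not_lt.1 hle)
  simp only at hm
  linarith
end

section
/- Suppose G₋ is a CDF with G₋(-x) = c·x^{-k} for x > x₀ (c, k > 0), and G₊ the CDF with density e^x relative to the measure of G₋. Then there exists x₁ such that for all x > x₁, G₊(−x) ≥ (ck/1.1)·e^{−1.1x}, and consequently D₋(x) = log(G₊(−x)/G₋(−x)) ≥ −1.2x for all sufficiently large x. -/
open MeasureTheory Set Filter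

theorem stmt_17 (νp νm : Measure ℝ) [IsProbabilityMeasure νp] [IsProbabilityMeasure νm]
    (hac : νp ≪ νm) (hac' : νm ≪ νp)
    (hrn : ∀ᵐ x ∂νm, νp.rnDeriv νm x = ENNReal.ofReal (Real.exp x))
    (Gp Gm : ℝ → ℝ)
    (hGp : ∀ x, Gp x = (νp (Iic x)).toReal)
    (hGm : ∀ x, Gm x = (νm (Iic x)).toReal)
    (c k x₀ : ℝ) (hc : 0 < c) (hk : 0 < k) (hx₀ : 0 < x₀)
    (htail : ∀ x, x > x₀ → Gm (-x) = c * x ^ (-k)) :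
    (∃ x₁ : ℝ, ∀ x > x₁, (c * k / 1.1) * Real.exp (-1.1 * x) ≤ Gp (-x)) ∧
      ∃ x₂ : ℝ, ∀ x > x₂, (-1.2) * x ≤ Real.log (Gp (-x) / Gm (-x)) := by
  have hd : 0 < 1 - (1.05 : ℝ) ^ (-k) := by
    have := Real.rpow_lt_one_of_one_lt_of_neg (x := (1.05 : ℝ)) (z := -k) (by norm_num) (by linarith)
    linarith
  set d : ℝ := 1 - (1.05 : ℝ) ^ (-k) with hddef
  have key : ∀ x > x₀, Real.exp (-1.05 * x) * (c * x ^ (-k) * d) ≤ Gp (-x) := by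
    intro x hx
    have hx0 : 0 < x := by linarith
    have h1 := htail x hx
    have h2 := htail (1.05 * x) (by nlinarith)
    rw [Real.mul_rpow (by norm_num) hx0.le] at h2
    have hle : -(1.05 * x) ≤ -x := by linarith
    have hIoc : νm.real (Ioc (-(1.05 * x)) (-x)) = c * x ^ (-k) * d := by
      have hset : Ioc (-(1.05 * x)) (-x) = Iic (-x) \ Iic (-(1.05 * x)) := by
        ext z
        simp only [mem_Ioc, mem_diff, mem_Iic, not_le]
        tauto
      rw [hset, measureReal_diff (Iic_subset_Iic.2 hle) measurableSet_Iic]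
      rw [hGm] at h1 h2
      simp only [measureReal_def]
      rw [h1, h2, hddef]; ring
    have hlow : ENNReal.ofReal (Real.exp (-1.05 * x)) * νm (Ioc (-(1.05 * x)) (-x))
        ≤ νp (Ioc (-(1.05 * x)) (-x)) := by
      rw [← Measure.setLIntegral_rnDeriv hac, ← setLIntegral_const]
      apply setLIntegral_mono_ae' measurableSet_Ioc
      filter_upwards [hrn] with z hz hzm
      rw [hz]
      apply ENNReal.ofReal_le_ofReal
      apply Real.exp_le_exp.2
      have := hzm.1
      linarith
    rw [hGp, ← hIoc, measureReal_def]
    have h3 := ENNReal.toReal_mono (measure_ne_top νp _)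
      (hlow.trans (measure_mono (Ioc_subset_Iic_self)))
    rwa [ENNReal.toReal_mul, ENNReal.toReal_ofReal (Real.exp_pos _).le] at h3
  constructor
  · have ht := tendsto_exp_mul_div_rpow_atTop k 0.05 (by norm_num)
    obtain ⟨N, hN⟩ := eventually_atTop.1 (ht.eventually_ge_atTop (k / 1.1 / d))
    refine ⟨max N x₀, fun x hx => ?_⟩
    have hxN := hN x ((le_max_left _ _).trans hx.le)
    have hxx : x > x₀ := (le_max_right _ _).trans_lt hx
    refine le_trans ?_ (key x hxx)
    rw [div_le_iff₀ hd, div_eq_mul_inv (Real.exp _), ← Real.rpow_neg (by linarith)] at hxN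
    have he : Real.exp (-1.05 * x) = Real.exp (-1.1 * x) * Real.exp (0.05 * x) := by
      rw [← Real.exp_add]; congr 1; ring
    rw [he]
    have := mul_le_mul_of_nonneg_left hxN (mul_pos hc (Real.exp_pos (-1.1 * x))).le
    calc _ = c * Real.exp (-1.1 * x) * (k / 1.1) := by ring
      _ ≤ _ := this
      _ = _ := by ring
  · refine ⟨max x₀ (-Real.log d / 0.15), fun x hx => ?_⟩
    have hxx : x > x₀ := (le_max_left _ _).trans_lt hx
    have hxd : -Real.log d / 0.15 < x := (le_max_right _ _).trans_lt hx
    rw [div_lt_iff₀ (by norm_num)] at hxd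
    have hm : 0 < c * x ^ (-k) := mul_pos hc (Real.rpow_pos_of_pos (by linarith) _)
    have h4 : Real.exp (-1.05 * x) * d ≤ Gp (-x) / Gm (-x) := by
      rw [htail x hxx, le_div_iff₀ hm]
      have := key x hxx
      linarith
    have h5 := Real.log_le_log (mul_pos (Real.exp_pos _) hd) h4
    rw [Real.log_mul (Real.exp_pos _).ne' hd.ne', Real.log_exp] at h5
    linarith
end
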